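/- If φ: M_n → M_m satisfies the Schwarz inequality φ(K*K) ≥ φ(K)*φ(K) for all K, then for all positive definite X, Y ∈ M_m, all K ∈ M_n, and all r ∈ (0,1): Tr[φ(K)* Y^{1−r} φ(K) X^{r}] ≤ Tr[K* φ*(Y)^{1−r} K φ*(X)^{r}]. -/

import Mathlib

open Matrix ComplexOrder
noncomputable section

/-- Real power of a matrix, defined via the spectral decomposition when the matrix
is Hermitian (with `0^r = 0` on the kernel), and junk value `0` otherwise. -/
def mpow {m : ℕ} (X : Matrix (Fin m) (Fin m) ℂ) (r : ℝ) : Matrix (Fin m) (Fin m) ℂ :=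
  if hX : X.IsHermitian then
    (hX.eigenvectorUnitary : Matrix (Fin m) (Fin m) ℂ) *
      Matrix.diagonal (fun i => ((if hX.eigenvalues i = 0 then 0
        else Real.rpow (hX.eigenvalues i) r : ℝ) : ℂ)) *
      (star (hX.eigenvectorUnitary : Matrix (Fin m) (Fin m) ℂ))
  else 0

open MeasureTheory in
theorem lm_sum_le {ι κ : Type} [Fintype ι] [Fintype κ] (r : ℝ) (hr : r ∈ Set.Ioo (0:ℝ) 1)
    (a b w : ι → ℝ) (c d z : κ → ℝ) (ha : ∀ i, 0 ≤ a i) (hb : ∀ i, 0 ≤ b i)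
    (hc : ∀ i, 0 ≤ c i) (hd : ∀ i, 0 ≤ d i)
    (h : ∀ t : ℝ, 0 < t → ∑ k, c k * d k / (t * c k + d k) * z k
        ≤ ∑ i, a i * b i / (t * a i + b i) * w i) :
    ∑ k, c k ^ (1 - r) * d k ^ r * z k ≤ ∑ i, a i ^ (1 - r) * b i ^ r * w i := by
  set C := ∫ t in Set.Ioi 0, Real.rpowIntegrand₀₁ r t 1 with hC
  have hCpos : 0 < C := Real.integral_rpowIntegrand₀₁_one_pos hr
  have key : ∀ (x y : ℝ), 0 ≤ x → 0 ≤ y →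
      ∫ t in Set.Ioi 0, x * Real.rpowIntegrand₀₁ r t (y / x) = x ^ (1 - r) * y ^ r * C := by
    intro x y hx hy
    rw [integral_const_mul, Real.integral_rpowIntegrand₀₁_eq_rpow_mul_const hr (by positivity)]
    rcases hx.eq_or_lt with rfl | hx
    · rw [Real.zero_rpow (by linarith [hr.2])]; simp
    · rw [Real.div_rpow hy hx.le, Real.rpow_sub hx, Real.rpow_one]; ring
  have key2 : ∀ (x y t : ℝ), 0 ≤ x → 0 ≤ y → 0 < t →
      x * Real.rpowIntegrand₀₁ r t (y / x) = t ^ (r - 1) * (x * y / (t * x + y)) := by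
    intro x y t hx hy ht
    rw [Real.rpowIntegrand₀₁_eq_pow_div hr ht.le (by positivity)]
    rcases hx.eq_or_lt with rfl | hx
    · simp
    · have : 0 < t * x + y := by positivity
      field_simp
  have int : ∀ (x y z : ℝ), 0 ≤ x → 0 ≤ y →
      IntegrableOn (fun t => x * Real.rpowIntegrand₀₁ r t (y / x) * z) (Set.Ioi 0) := by
    intro x y z hx hy
    exact ((Real.integrableOn_rpowIntegrand₀₁_Ioi hr (by positivity)).const_mul x).mul_const z
  have e1 : ∀ {ι : Type} [Fintype ι] (a b w : ι → ℝ), (∀ i, 0 ≤ a i) → (∀ i, 0 ≤ b i) →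
      ∫ t in Set.Ioi 0, ∑ i, a i * Real.rpowIntegrand₀₁ r t (b i / a i) * w i
        = (∑ i, a i ^ (1 - r) * b i ^ r * w i) * C := by
    intro ι _ a b w ha hb
    rw [integral_finsetSum _ (fun i _ => int _ _ _ (ha i) (hb i)), Finset.sum_mul]
    refine Finset.sum_congr rfl fun i _ => ?_
    rw [integral_mul_const, key _ _ (ha i) (hb i)]; ring
  have e2 : ∀ {ι : Type} [Fintype ι] (a b w : ι → ℝ), (∀ i, 0 ≤ a i) → (∀ i, 0 ≤ b i) →
      ∀ t : ℝ, 0 < t → ∑ i, a i * Real.rpowIntegrand₀₁ r t (b i / a i) * w i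
        = t ^ (r - 1) * ∑ i, a i * b i / (t * a i + b i) * w i := by
    intro ι _ a b w ha hb t ht
    rw [Finset.mul_sum]
    refine Finset.sum_congr rfl fun i _ => ?_
    rw [key2 _ _ _ (ha i) (hb i) ht, mul_assoc]
  refine le_of_mul_le_mul_right ?_ hCpos
  rw [← e1 c d z hc hd, ← e1 a b w ha hb]
  refine setIntegral_mono_on (integrable_finsetSum _ fun i _ => int _ _ _ (hc i) (hd i))
    (integrable_finsetSum _ fun i _ => int _ _ _ (ha i) (hb i)) measurableSet_Ioi ?_
  intro t ht
  have ht : 0 < t := ht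
  rw [e2 c d z hc hd t ht, e2 a b w ha hb t ht]
  exact mul_le_mul_of_nonneg_left (h t ht) (by positivity)

theorem lm_trace {n : ℕ} (K U V : Matrix (Fin n) (Fin n) ℂ) (a b : Fin n → ℝ) :
    (Kᴴ * (U * diagonal (fun i => (a i : ℂ)) * Uᴴ) * K *
      (V * diagonal (fun i => (b i : ℂ)) * Vᴴ)).trace.re
      = ∑ p : Fin n × Fin n, a p.1 * b p.2 * ‖(Uᴴ * K * V) p.1 p.2‖ ^ 2 := by
  have h : (Kᴴ * (U * diagonal (fun i => (a i : ℂ)) * Uᴴ) * K *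
      (V * diagonal (fun i => (b i : ℂ)) * Vᴴ)).trace
      = ((Uᴴ * K * V)ᴴ * diagonal (fun i => (a i : ℂ)) * (Uᴴ * K * V) *
        diagonal (fun i => (b i : ℂ))).trace := by
    rw [show Kᴴ * (U * diagonal (fun i => (a i : ℂ)) * Uᴴ) * K *
      (V * diagonal (fun i => (b i : ℂ)) * Vᴴ) = (Kᴴ * (U * diagonal (fun i => (a i : ℂ)) * Uᴴ) * K *
      (V * diagonal (fun i => (b i : ℂ)))) * Vᴴ by simp only [Matrix.mul_assoc], Matrix.trace_mul_comm]
    simp only [Matrix.mul_assoc, conjTranspose_mul, conjTranspose_conjTranspose]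
  rw [h]
  generalize Uᴴ * K * V = M
  simp only [Matrix.trace, Matrix.diag, Matrix.mul_diagonal]
  rw [Fintype.sum_prod_type, Finset.sum_comm, Complex.re_sum]
  refine Finset.sum_congr rfl fun j _ => ?_
  rw [Matrix.mul_apply, Finset.sum_mul, Complex.re_sum]
  refine Finset.sum_congr rfl fun i _ => ?_
  rw [Matrix.mul_diagonal, conjTranspose_apply, Complex.sq_norm, Complex.normSq_apply]
  simp
  ring

theorem lm_psd {n : ℕ} (A : Matrix (Fin n) (Fin n) ℂ)
    (h : ∀ v : Fin n → ℂ, 0 ≤ star v ⬝ᵥ (A *ᵥ v)) : A.PosSemidef := by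
  rw [← Matrix.isPositive_toEuclideanLin_iff, LinearMap.isPositive_iff_complex]
  intro x
  have h1 := Complex.le_def.mp (h x.ofLp)
  have h2 : inner ℂ (A.toEuclideanLin x) x = star (star x.ofLp ⬝ᵥ (A *ᵥ x.ofLp)) := by
    rw [EuclideanSpace.inner_eq_star_dotProduct, ← Matrix.star_dotProduct_star, star_star]
    rw [dotProduct_comm]
    rfl
  rw [h2]
  constructor
  · apply Complex.ext <;> simp [← h1.2]
  · simpa using h1.1

theorem lm_trace_nonneg {n : ℕ} {A B : Matrix (Fin n) (Fin n) ℂ} (hA : A.PosSemidef)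
    (hB : B.PosSemidef) : 0 ≤ (A * B).trace := by
  obtain ⟨C, rfl⟩ : ∃ C : Matrix (Fin n) (Fin n) ℂ, A = Cᴴ * C := by
    open scoped MatrixOrder in
    exact CStarAlgebra.nonneg_iff_eq_star_mul_self.mp hA.nonneg
  rw [Matrix.mul_assoc, Matrix.trace_mul_comm]
  exact (hB.mul_mul_conjTranspose_same C).trace_nonneg

theorem lm_star {n m : ℕ} (φ : Matrix (Fin n) (Fin n) ℂ →ₗ[ℂ] Matrix (Fin m) (Fin m) ℂ)
    (hφ : ∀ X : Matrix (Fin n) (Fin n) ℂ, X.PosSemidef → (φ X).PosSemidef)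
    (K : Matrix (Fin n) (Fin n) ℂ) : φ Kᴴ = (φ K)ᴴ := by
  have h0 := (hφ _ (posSemidef_conjTranspose_mul_self K)).1
  have h1 := (hφ _ (PosSemidef.one)).1
  have h2 := (hφ _ (posSemidef_conjTranspose_mul_self (K + 1))).1
  have h3 := (hφ _ (posSemidef_conjTranspose_mul_self (K + Complex.I • 1))).1
  unfold IsHermitian at h0 h1 h2 h3
  simp [Matrix.add_mul, Matrix.mul_add, conjTranspose_add, h0, h1, smul_smul] at h2 h3
  ext i j
  have e2 := congrFun (congrFun h2 i) j
  have e3 := congrFun (congrFun h3 i) j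
  simp at e2 e3
  rw [conjTranspose_apply, ← starRingEnd_apply]
  linear_combination (-1/2 : ℂ) * e2 + (Complex.I / 2) * e3 - (1/2 : ℂ) *
    ((starRingEnd ℂ) (φ K j i) - (starRingEnd ℂ) (φ Kᴴ j i) + φ K i j - φ Kᴴ i j) * Complex.I_sq

theorem lm_mpow {n : ℕ} {A : Matrix (Fin n) (Fin n) ℂ} (hA : A.IsHermitian) {r : ℝ} (hr : r ≠ 0) :
    mpow A r = (hA.eigenvectorUnitary : Matrix (Fin n) (Fin n) ℂ) *
      diagonal (fun i => ((hA.eigenvalues i ^ r : ℝ) : ℂ)) *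
        (hA.eigenvectorUnitary : Matrix (Fin n) (Fin n) ℂ)ᴴ := by
  rw [mpow, dif_pos hA]
  congr 3
  funext i
  split_ifs with h
  · rw [h, Real.zero_rpow hr]
  · rfl

theorem lm_spec {n : ℕ} {A : Matrix (Fin n) (Fin n) ℂ} (hA : A.IsHermitian) :
    A = (hA.eigenvectorUnitary : Matrix (Fin n) (Fin n) ℂ) *
      diagonal (fun i => ((hA.eigenvalues i : ℝ) : ℂ)) *
        (hA.eigenvectorUnitary : Matrix (Fin n) (Fin n) ℂ)ᴴ := by
  exact hA.spectral_theorem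

/-- left trace form -/
theorem lm_left {n : ℕ} {A : Matrix (Fin n) (Fin n) ℂ} (hA : A.IsHermitian)
    (V K : Matrix (Fin n) (Fin n) ℂ) (hV : V * Vᴴ = 1) :
    (Kᴴ * A * K).trace.re = ∑ p : Fin n × Fin n, hA.eigenvalues p.1 *
      ‖((hA.eigenvectorUnitary : Matrix (Fin n) (Fin n) ℂ)ᴴ * K * V) p.1 p.2‖ ^ 2 := by
  have := lm_trace K (hA.eigenvectorUnitary : Matrix (Fin n) (Fin n) ℂ) V hA.eigenvalues (fun _ => 1)
  rw [← lm_spec hA] at this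
  simpa [hV] using this

/-- right trace form -/
theorem lm_right {n : ℕ} {A : Matrix (Fin n) (Fin n) ℂ} (hA : A.IsHermitian)
    (V K : Matrix (Fin n) (Fin n) ℂ) (hV : V * Vᴴ = 1) :
    (Kᴴ * K * A).trace.re = ∑ p : Fin n × Fin n, hA.eigenvalues p.2 *
      ‖(Vᴴ * K * (hA.eigenvectorUnitary : Matrix (Fin n) (Fin n) ℂ)) p.1 p.2‖ ^ 2 := by
  have := lm_trace K V (hA.eigenvectorUnitary : Matrix (Fin n) (Fin n) ℂ) (fun _ => 1) hA.eigenvalues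
  rw [← lm_spec hA] at this
  simpa [hV] using this

theorem lm_scalar (t c d : ℝ) (ht : 0 < t) (hc : 0 ≤ c) (hd : 0 ≤ d) (z w : ℂ) :
    c * d / (t * c + d) * ‖z + w‖ ^ 2 ≤ c * ‖z‖ ^ 2 + t⁻¹ * (d * ‖w‖ ^ 2) := by
  have h0 : ‖z + w‖ ^ 2 ≤ (‖z‖ + ‖w‖) ^ 2 := by gcongr; exact norm_add_le z w
  rcases (show 0 ≤ t * c + d by positivity).eq_or_lt with h | h
  · rw [← h]; simp; positivity
  refine (mul_le_mul_of_nonneg_left h0 (by positivity)).trans ?_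
  rw [div_mul_eq_mul_div, div_le_iff₀ h, ← sub_nonneg]
  have : (c * ‖z‖ ^ 2 + t⁻¹ * (d * ‖w‖ ^ 2)) * (t * c + d) - c * d * (‖z‖ + ‖w‖) ^ 2
    = t⁻¹ * (t * c * ‖z‖ - d * ‖w‖) ^ 2 := by
    field_simp; ring
  rw [this]; positivity

theorem lm_split (t a b : ℝ) (ht : 0 < t) (ha : 0 ≤ a) (hb : 0 ≤ b) (z : ℂ) :
    a * ‖((b / (t * a + b) : ℝ) : ℂ) * z‖ ^ 2 + t⁻¹ * (b * ‖z - ((b / (t * a + b) : ℝ) : ℂ) * z‖ ^ 2)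
      = a * b / (t * a + b) * ‖z‖ ^ 2 := by
  rcases (show 0 ≤ t * a + b by positivity).eq_or_lt with h | h
  · have h1 : b = 0 := by nlinarith [mul_nonneg ht.le ha]
    subst h1; simp
  have : z - ((b / (t * a + b) : ℝ) : ℂ) * z = ((1 - b / (t * a + b) : ℝ) : ℂ) * z := by
    push_cast; ring
  rw [this, norm_mul, norm_mul, Complex.norm_real, Complex.norm_real, mul_pow, mul_pow,
    Real.norm_eq_abs, Real.norm_eq_abs, sq_abs, sq_abs]
  have h2 : 1 - b / (t * a + b) = t * a / (t * a + b) := by field_simp; ring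
  rw [h2]
  generalize hs : t * a + b = s at *
  field_simp
  rw [← hs]
  ring

/-- Monotonicity version of the Lieb concavity theorem: if `φ` satisfies the Schwarz
inequality, then `Tr[φ(K)ᴴ Y^{1−r} φ(K) X^r] ≤ Tr[Kᴴ φ*(Y)^{1−r} K φ*(X)^r]`
for all positive definite `X, Y` and `0 < r < 1`. -/
theorem lieb_monotonicity {n m : ℕ}
    (φ : Matrix (Fin n) (Fin n) ℂ →ₗ[ℂ] Matrix (Fin m) (Fin m) ℂ)
    (hφ : ∀ X : Matrix (Fin n) (Fin n) ℂ, X.PosSemidef → (φ X).PosSemidef)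
    (hSchwarz : ∀ K : Matrix (Fin n) (Fin n) ℂ,
      (φ (Kᴴ * K) - (φ K)ᴴ * φ K).PosSemidef)
    (ψ : Matrix (Fin m) (Fin m) ℂ →ₗ[ℂ] Matrix (Fin n) (Fin n) ℂ)
    (hadj : ∀ (A : Matrix (Fin m) (Fin m) ℂ) (B : Matrix (Fin n) (Fin n) ℂ),
      (Aᴴ * φ B).trace = ((ψ A)ᴴ * B).trace)
    (X Y : Matrix (Fin m) (Fin m) ℂ) (hX : X.PosDef) (hY : Y.PosDef)
    (K : Matrix (Fin n) (Fin n) ℂ) (r : ℝ) (hr0 : 0 < r) (hr1 : r < 1) :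
    ((φ K)ᴴ * mpow Y (1 - r) * φ K * mpow X r).trace.re ≤
      (Kᴴ * mpow (ψ Y) (1 - r) * K * mpow (ψ X) r).trace.re := by
  have hψ : ∀ A : Matrix (Fin m) (Fin m) ℂ, A.PosSemidef → (ψ A).PosSemidef := by
    intro A hA
    have : ((ψ A)ᴴ).PosSemidef := by
      refine lm_psd _ fun v => ?_
      have h := hadj A (vecMulVec v (star v))
      rw [hA.1, Matrix.trace_mul_comm, Matrix.mul_vecMulVec, Matrix.trace_vecMulVec, dotProduct_comm] at h
      rw [← h]
      exact lm_trace_nonneg (hφ _ (posSemidef_vecMulVec_self_star v)) hA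
    simpa using this.conjTranspose
  have hL : ∀ A : Matrix (Fin m) (Fin m) ℂ, A.PosSemidef → ∀ L,
      ((φ L)ᴴ * φ L * A).trace.re ≤ (Lᴴ * L * ψ A).trace.re := by
    intro A hA L
    have h := lm_trace_nonneg hA (hSchwarz L)
    have h' := hadj A (Lᴴ * L)
    rw [hA.1, (hψ A hA).1] at h'
    rw [Matrix.mul_sub, Matrix.trace_sub, h'] at h
    have := (Complex.le_def.mp h).1
    rw [Matrix.trace_mul_comm _ A, Matrix.trace_mul_comm _ (ψ A)]
    simpa using this
  have hR : ∀ A : Matrix (Fin m) (Fin m) ℂ, A.PosSemidef → ∀ L,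
      ((φ L)ᴴ * A * φ L).trace.re ≤ (Lᴴ * ψ A * L).trace.re := by
    intro A hA L
    have h := hL A hA Lᴴ
    rw [lm_star φ hφ, conjTranspose_conjTranspose, conjTranspose_conjTranspose] at h
    rwa [Matrix.mul_assoc, Matrix.trace_mul_comm, Matrix.mul_assoc L, Matrix.trace_mul_comm L] at h
  have hX' := hψ X hX.posSemidef
  have hY' := hψ Y hY.posSemidef
  have h1r : 1 - r ≠ 0 := by linarith
  rw [lm_mpow hX.1 hr0.ne', lm_mpow hY.1 h1r, lm_mpow hX'.1 hr0.ne', lm_mpow hY'.1 h1r,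
    lm_trace, lm_trace]
  refine lm_sum_le r ⟨hr0, hr1⟩ (fun p : Fin n × Fin n => hY'.1.eigenvalues p.1)
    (fun p => hX'.1.eigenvalues p.2) _ (fun p : Fin m × Fin m => hY.1.eigenvalues p.1)
    (fun p => hX.1.eigenvalues p.2) _ (fun p => hY'.eigenvalues_nonneg _)
    (fun p => hX'.eigenvalues_nonneg _) (fun p => hY.posSemidef.eigenvalues_nonneg _)
    (fun p => hX.posSemidef.eigenvalues_nonneg _) ?_
  intro t ht
  set U : Matrix (Fin n) (Fin n) ℂ := (hY'.1.eigenvectorUnitary : Matrix (Fin n) (Fin n) ℂ) with hU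
  set V : Matrix (Fin n) (Fin n) ℂ := (hX'.1.eigenvectorUnitary : Matrix (Fin n) (Fin n) ℂ) with hV
  set P : Matrix (Fin m) (Fin m) ℂ := (hY.1.eigenvectorUnitary : Matrix (Fin m) (Fin m) ℂ) with hP
  set Q : Matrix (Fin m) (Fin m) ℂ := (hX.1.eigenvectorUnitary : Matrix (Fin m) (Fin m) ℂ) with hQ
  have uU : U * Uᴴ = 1 := Unitary.coe_mul_star_self _
  have uV : V * Vᴴ = 1 := Unitary.coe_mul_star_self _
  have uP : P * Pᴴ = 1 := Unitary.coe_mul_star_self _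
  have uQ : Q * Qᴴ = 1 := Unitary.coe_mul_star_self _
  have uU' : Uᴴ * U = 1 := Unitary.coe_star_mul_self _
  have uV' : Vᴴ * V = 1 := Unitary.coe_star_mul_self _
  set K₁' : Matrix (Fin n) (Fin n) ℂ := Matrix.of fun i j =>
    ((hX'.1.eigenvalues j / (t * hY'.1.eigenvalues i + hX'.1.eigenvalues j) : ℝ) : ℂ)
      * (Uᴴ * K * V) i j with hK₁'
  set K₁ := U * K₁' * Vᴴ with hK₁
  set K₂ := K - K₁ with hK₂
  have c1 : Uᴴ * K₁ * V = K₁' := by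
    rw [hK₁, show Uᴴ * (U * K₁' * Vᴴ) * V = (Uᴴ * U) * K₁' * (Vᴴ * V) by
      simp only [Matrix.mul_assoc], uU', uV', Matrix.one_mul, Matrix.mul_one]
  have c2 : Uᴴ * K₂ * V = Uᴴ * K * V - K₁' := by
    rw [hK₂, Matrix.mul_sub, Matrix.sub_mul, c1]
  have hsum : φ K = φ K₁ + φ K₂ := by rw [← map_add, hK₂, add_sub_cancel]
  have i1 := hR Y hY.posSemidef K₁
  have i2 := hL X hX.posSemidef K₂
  rw [lm_left hY.1 Q _ uQ, lm_left hY'.1 V _ uV, ← hU, ← hP, c1] at i1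
  rw [lm_right hX.1 P _ uP, lm_right hX'.1 U _ uU, ← hV, ← hQ, c2] at i2
  have i3 := add_le_add i1 (mul_le_mul_of_nonneg_left i2 (inv_nonneg.mpr ht.le))
  rw [Finset.mul_sum, Finset.mul_sum, ← Finset.sum_add_distrib, ← Finset.sum_add_distrib] at i3
  refine le_trans (Finset.sum_le_sum fun p _ => ?_) (i3.trans (Finset.sum_le_sum fun p _ => ?_))
  · rw [hsum, Matrix.mul_add, Matrix.add_mul, Matrix.add_apply]
    exact lm_scalar t _ _ ht (hY.posSemidef.eigenvalues_nonneg _) (hX.posSemidef.eigenvalues_nonneg _) _ _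
  · exact (lm_split t _ _ ht (hY'.eigenvalues_nonneg _) (hX'.eigenvalues_nonneg _) _).le
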